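/- Let a_n denote the number of (3,0)-threshold sequences of length n and b_n the number of (3,1)-threshold sequences of length n, with the conventions a_0 = b_0 = 1. Then for every integer n ≥ 1, b_n − a_n = Σ_{h=0}^{n−1} a_h·a_{n−h} = Σ_{h=0}^{n−1} b_h·b_{n−h−1} = (2/(n+1))·binom(3n, n−1). In particular the number of proper (3,1)-threshold sequences of length n (those with s_n = 3n+1) equals (2/(n+1))·binom(3n, n−1). -/

import Mathlib

/-- `a n` is the number of (3,0)-threshold sequences of length `n`, with `a 0 = 1`. -/
noncomputable def a (n : ℕ) : ℕ :=
  if n = 0 then 1 else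
    Set.ncard {s : Fin n → ℤ | StrictMono s ∧
      ∀ i : Fin n, 3 * ((i : ℤ) + 1) ≤ s i ∧ s i ≤ 3 * n}

/-- `b n` is the number of (3,1)-threshold sequences of length `n`, with `b 0 = 1`. -/
noncomputable def b (n : ℕ) : ℕ :=
  if n = 0 then 1 else
    Set.ncard {s : Fin n → ℤ | StrictMono s ∧
      ∀ i : Fin n, 3 * ((i : ℤ) + 1) ≤ s i ∧ s i ≤ 3 * n + 1}

/-- The coefficient of `x ^ n` in `B ^ p`, where `B = 1 + x * B ^ 3`. -/
def fussCoeff : ℕ → ℕ → ℕ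
  | _, 0 => 1
  | 0, _ + 1 => 0
  | p + 1, n + 1 => fussCoeff p (n + 1) + fussCoeff (p + 3) n
termination_by p n => (n, p)

@[simp] theorem fussCoeff_zero_right (p : ℕ) : fussCoeff p 0 = 1 := by
  simp [fussCoeff]

@[simp] theorem fussCoeff_zero_succ (n : ℕ) : fussCoeff 0 (n + 1) = 0 := by
  simp [fussCoeff]

theorem fussCoeff_succ_succ (p n : ℕ) :
    fussCoeff (p + 1) (n + 1) = fussCoeff p (n + 1) + fussCoeff (p + 3) n := by
  rw [fussCoeff]

/-- The coefficientwise form of `B ^ p * B ^ q = B ^ (p + q)`. -/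
theorem sum_fussCoeff_mul (n p q : ℕ) :
    ∑ h ∈ Finset.range (n + 1), fussCoeff p h * fussCoeff q (n - h) = fussCoeff (p + q) n := by
  induction n generalizing p with
  | zero => simp
  | succ n ihn =>
    induction p with
    | zero => rw [Finset.sum_range_succ']; simp
    | succ p ihp =>
      rw [Finset.sum_range_succ'] at ihp ⊢
      have key := ihn (p + 3)
      simp only [Nat.add_sub_add_right, fussCoeff_succ_succ, add_mul, Finset.sum_add_distrib,
        fussCoeff_zero_right] at ihp ⊢
      rw [key, show p + 1 + q = p + q + 1 by ring, fussCoeff_succ_succ, ← ihp,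
        show p + 3 + q = p + q + 3 by ring]
      ring

theorem fussCoeff_mul_eq (p n : ℕ) :
    (fussCoeff p n : ℚ) * (p + 3 * n) = p * (p + 3 * n).choose n := by
  induction n generalizing p with
  | zero => simp
  | succ n ihn =>
    induction p with
    | zero => simp
    | succ p ihp =>
      have h := ihn (p + 3)
      rw [show p + 3 + 3 * n = p + 3 * n + 3 by ring] at h
      rw [show p + 3 * (n + 1) = p + 3 * n + 3 by ring] at ihp
      rw [fussCoeff_succ_succ, show p + 1 + 3 * (n + 1) = p + 3 * n + 3 + 1 by ring,
        Nat.choose_succ_succ]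
      have hc : ((p + 3 * n + 3).choose (n + 1) : ℚ) * (n + 1)
          = (p + 3 * n + 3).choose n * (p + 2 * n + 3) := by
        have := Nat.choose_succ_right_eq (p + 3 * n + 3) n
        rw [show p + 3 * n + 3 - n = p + 2 * n + 3 by omega] at this
        exact_mod_cast this
      push_cast at *
      have hM : (p : ℚ) + 3 * n + 3 ≠ 0 := by positivity
      apply mul_right_cancel₀ hM
      linear_combination (p + 3 * n + 4 : ℚ) * (ihp + h) - 3 * hc

/-- Strictly increasing integer sequences with `3 * i ≤ s_i ≤ m` (indices starting at one). -/
def thresholdSet (n : ℕ) (m : ℤ) : Set (Fin n → ℤ) :=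
  {s | StrictMono s ∧ ∀ i : Fin n, 3 * ((i : ℤ) + 1) ≤ s i ∧ s i ≤ m}

theorem finite_thresholdSet (n : ℕ) (m : ℤ) : (thresholdSet n m).Finite := by
  refine (Set.Finite.pi' (fun _ : Fin n => Set.finite_Icc 0 m)).subset ?_
  rintro s ⟨-, hs⟩ i
  exact ⟨by have := (hs i).1; omega, (hs i).2⟩

theorem thresholdSet_succ (n : ℕ) (m : ℤ) (hm : 3 * ((n : ℤ) + 1) ≤ m) :
    thresholdSet (n + 1) m = thresholdSet (n + 1) (m - 1) ∪
      (fun s : Fin n → ℤ => (Fin.snoc s m : Fin (n + 1) → ℤ)) '' thresholdSet n (m - 1) := by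
  ext s
  constructor
  · rintro ⟨hs, hb⟩
    by_cases hl : s (Fin.last n) = m
    · refine Or.inr ⟨Fin.init s, ⟨?_, fun i => ⟨?_, ?_⟩⟩, ?_⟩
      · exact fun i j hij => hs (Fin.castSucc_lt_castSucc_iff.2 hij)
      · simpa [Fin.init] using (hb i.castSucc).1
      · have := hs (Fin.castSucc_lt_last i)
        simp only [Fin.init]
        omega
      · simp [← hl]
    · refine Or.inl ⟨hs, fun i => ⟨(hb i).1, ?_⟩⟩
      have := hs.monotone (Fin.le_last i)
      have := (hb (Fin.last n)).2
      omega
  · rintro (⟨hs, hb⟩ | ⟨s, ⟨hs, hb⟩, rfl⟩)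
    · exact ⟨hs, fun i => ⟨(hb i).1, by have := (hb i).2; omega⟩⟩
    · refine ⟨fun i j hij => ?_, fun i => ?_⟩
      · induction j using Fin.lastCases with
        | last =>
          induction i using Fin.lastCases with
          | last => exact absurd hij (lt_irrefl _)
          | cast i => have := (hb i).2; simp; omega
        | cast j =>
          induction i using Fin.lastCases with
          | last => exact absurd (hij.trans (Fin.castSucc_lt_last j)) (lt_irrefl _)
          | cast i => simpa using hs (Fin.castSucc_lt_castSucc_iff.1 hij)
      · induction i using Fin.lastCases with
        | last => simpa using hm
        | cast i => have := hb i; simp; omega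

theorem ncard_thresholdSet (n p : ℕ) :
    (thresholdSet n (3 * n - 1 + p)).ncard = fussCoeff p n := by
  induction n generalizing p with
  | zero =>
    rw [fussCoeff_zero_right, Set.ncard_eq_one]
    refine ⟨Fin.elim0, Set.eq_singleton_iff_unique_mem.2
      ⟨⟨fun i => i.elim0, fun i => i.elim0⟩, fun _ _ => Subsingleton.elim _ _⟩⟩
  | succ n ihn =>
    induction p with
    | zero =>
      rw [fussCoeff_zero_succ, Set.ncard_eq_zero (finite_thresholdSet _ _),
        Set.eq_empty_iff_forall_notMem]
      rintro s ⟨-, hb⟩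
      have := hb (Fin.last n)
      simp at this
      omega
    | succ p ihp =>
      rw [thresholdSet_succ n _ (by push_cast; omega), Set.ncard_union_eq _
        (finite_thresholdSet _ _) ((finite_thresholdSet _ _).image _),
        Set.ncard_image_of_injective _
          (fun s t h => (Fin.snoc_injective2 (α := fun _ => ℤ) h).1),
        fussCoeff_succ_succ, ← ihp, ← ihn (p + 3)]
      · congr 3 <;> push_cast <;> ring
      · rw [Set.disjoint_left]
        rintro _ ⟨-, hb⟩ ⟨s, -, rfl⟩
        have := (hb (Fin.last n)).2
        simp at this

theorem a_eq_fussCoeff (n : ℕ) : a n = fussCoeff 1 n := by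
  rcases Nat.eq_zero_or_pos n with rfl | hn
  · simp [a]
  · rw [a, if_neg hn.ne', ← ncard_thresholdSet]
    simp [thresholdSet]

theorem b_eq_fussCoeff (n : ℕ) : b n = fussCoeff 2 n := by
  rcases Nat.eq_zero_or_pos n with rfl | hn
  · simp [b]
  · rw [b, if_neg hn.ne', ← ncard_thresholdSet, thresholdSet,
      show (3 * (n : ℤ) - 1 + (2 : ℕ)) = 3 * n + 1 by push_cast; ring]

theorem fussCoeff_four_eq (n : ℕ) :
    (fussCoeff 4 n : ℚ) = 2 / ((n + 1 : ℕ) + 1) * (3 * (n + 1)).choose n := by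
  have h := fussCoeff_mul_eq 4 n
  have hc : ((4 + 3 * n).choose n : ℚ) * (2 * n + 4) = (3 * (n + 1)).choose n * (3 * n + 4) := by
    have := Nat.choose_mul_succ_eq (3 * (n + 1)) n
    rw [show 3 * (n + 1) + 1 - n = 2 * n + 4 by omega,
      show 3 * (n + 1) + 1 = 4 + 3 * n by ring] at this
    have h' : ((3 * (n + 1)).choose n : ℚ) * (4 + 3 * n)
      = (4 + 3 * n).choose n * (2 * n + 4) := by exact_mod_cast this
    linear_combination -h'
  have h3 : (4 : ℚ) + 3 * n ≠ 0 := by positivity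
  have h2 : (n : ℚ) + 1 + 1 ≠ 0 := by positivity
  push_cast at h ⊢
  rw [div_mul_eq_mul_div, eq_div_iff h2]
  apply mul_right_cancel₀ h3
  linear_combination (n + 2 : ℚ) * h + 2 * hc

theorem ncard_proper (n : ℕ) :
    Set.ncard {s : Fin (n + 1) → ℤ | StrictMono s ∧
        (∀ i : Fin (n + 1), 3 * ((i : ℤ) + 1) ≤ s i ∧ s i ≤ 3 * (n + 1 : ℕ) + 1) ∧
        s (Fin.last n) = 3 * (n + 1 : ℕ) + 1} = fussCoeff 4 n := by
  have hset : {s : Fin (n + 1) → ℤ | StrictMono s ∧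
        (∀ i : Fin (n + 1), 3 * ((i : ℤ) + 1) ≤ s i ∧ s i ≤ 3 * (n + 1 : ℕ) + 1) ∧
        s (Fin.last n) = 3 * (n + 1 : ℕ) + 1} =
      thresholdSet (n + 1) (3 * (n + 1 : ℕ) - 1 + (2 : ℕ)) \
        thresholdSet (n + 1) (3 * (n + 1 : ℕ) - 1 + (1 : ℕ)) := by
    ext s
    constructor
    · rintro ⟨hs, hb, hl⟩
      refine ⟨⟨hs, fun i => ⟨(hb i).1, by have := (hb i).2; push_cast at *; omega⟩⟩, ?_⟩
      rintro ⟨-, hb'⟩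
      have := (hb' (Fin.last n)).2
      push_cast at *
      omega
    · rintro ⟨⟨hs, hb⟩, hn⟩
      refine ⟨hs, fun i => ⟨(hb i).1, by have := (hb i).2; push_cast at *; omega⟩, ?_⟩
      by_contra hl
      refine hn ⟨hs, fun i => ⟨(hb i).1, ?_⟩⟩
      have := hs.monotone (Fin.le_last i)
      have := (hb (Fin.last n)).2
      push_cast at *
      omega
  rw [hset, Set.ncard_sdiff _ (finite_thresholdSet _ _), ncard_thresholdSet, ncard_thresholdSet,
    fussCoeff_succ_succ, Nat.add_sub_cancel_left]
  rintro s ⟨hs, hb⟩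
  exact ⟨hs, fun i => ⟨(hb i).1, by have := (hb i).2; push_cast at *; omega⟩⟩

/-- b_n − a_n = Σ_{h=0}^{n-1} a_h·a_{n-h} = Σ_{h=0}^{n-1} b_h·b_{n-h-1}
= (2/(n+1))·binom(3n, n−1), and this quantity also counts the proper
(3,1)-threshold sequences of length n. -/
theorem b_sub_a (n : ℕ) (hn : 1 ≤ n) :
    ((b n : ℚ) - a n = ∑ h ∈ Finset.range n, (a h : ℚ) * a (n - h)) ∧
    ((b n : ℚ) - a n = ∑ h ∈ Finset.range n, (b h : ℚ) * b (n - h - 1)) ∧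
    ((b n : ℚ) - a n = (2 / ((n : ℚ) + 1)) * Nat.choose (3 * n) (n - 1)) ∧
    (Set.ncard {s : Fin n → ℤ | StrictMono s ∧
        (∀ i : Fin n, 3 * ((i : ℤ) + 1) ≤ s i ∧ s i ≤ 3 * n + 1) ∧
        s ⟨n - 1, by omega⟩ = 3 * n + 1} : ℚ) =
      (2 / ((n : ℚ) + 1)) * Nat.choose (3 * n) (n - 1) := by
  obtain ⟨n, rfl⟩ : ∃ k, n = k + 1 := ⟨n - 1, by omega⟩
  have hsub : (b (n + 1) : ℚ) - a (n + 1) = fussCoeff 4 n := by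
    rw [a_eq_fussCoeff, b_eq_fussCoeff, fussCoeff_succ_succ]
    push_cast
    ring
  refine ⟨?_, ?_, ?_, ?_⟩
  · have h := sum_fussCoeff_mul (n + 1) 1 1
    rw [Finset.sum_range_succ, Nat.sub_self, fussCoeff_zero_right, mul_one] at h
    simp only [a_eq_fussCoeff, b_eq_fussCoeff]
    rw [← h]
    push_cast
    ring
  · rw [hsub]
    have h := sum_fussCoeff_mul n 2 2
    simp only [b_eq_fussCoeff, Nat.sub_right_comm _ _ 1, Nat.add_sub_cancel]
    exact_mod_cast h.symm
  · rw [hsub]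
    exact fussCoeff_four_eq n
  · exact (congrArg _ (ncard_proper n)).trans (fussCoeff_four_eq n)
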